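/- Fix d ≥ 2, 0 < u_min ≤ u_max, a Borel probability measure D on [u_min, u_max]^d × [u_min, u_max]^d × {−1, +1}, n ≥ 1, and δ > 0. Let ((u_1, v_1), y_1), …, ((u_n, v_n), y_n) be drawn i.i.d. from D and let (ŵ, p̂) ∈ Δ_{d−1} × ℝ be any empirical risk minimizer, i.e., R̂_n(ŵ, p̂) = inf_{(w,p) ∈ Δ_{d−1} × ℝ} R̂_n(w, p) (assumed to be attained). Then with probability at least 1 − δ over the sample, R(ŵ, p̂) − inf_{(w,p) ∈ Δ_{d−1} × ℝ} R(w, p) ≤ 16 √((8(d log₂ d + 1) log(n + 1) + log(8/δ))/n). -/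

import Mathlib

open MeasureTheory

/-- The weighted power mean `M(u; w, p)`. -/
noncomputable def pmean {d : ℕ} (u w : Fin d → ℝ) (p : ℝ) : ℝ :=
  if p = 0 then ∏ i, u i ^ w i else (∑ i, w i * u i ^ p) ^ (1 / p)

/-- `w` belongs to the probability simplex `Δ_{d-1}`. -/
def inSimplex {d : ℕ} (w : Fin d → ℝ) : Prop :=
  (∀ i, 0 ≤ w i) ∧ ∑ i, w i = 1

/-- The sign function: `+1` if `t ≥ 0`, `-1` if `t < 0`. -/
noncomputable def sgn (t : ℝ) : ℝ := if 0 ≤ t then 1 else -1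

/-- The comparison function `C((u,v); w, p) = sign(log M(u;w,p) - log M(v;w,p))`. -/
noncomputable def pcmp {d : ℕ} (u v w : Fin d → ℝ) (p : ℝ) : ℝ :=
  sgn (Real.log (pmean u w p) - Real.log (pmean v w p))

namespace PacAux

/-- the sign attached to a Boolean -/
noncomputable def sg (b : Bool) : ℝ := if b then 1 else -1

open Classical in
lemma rad_one (n : ℕ) (hn : 1 ≤ n) (c : Fin n → ℝ) (hc : ∀ i, |c i| ≤ 1) (a : ℝ) (ha : 0 < a) :
    ((Finset.univ.filter fun σ : Fin n → Bool => a < ∑ i, sg (σ i) * c i).card : ℝ)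
      ≤ 2 ^ n * Real.exp (-(a ^ 2 / (2 * n))) := by
  have hn0 : (0 : ℝ) < n := by exact_mod_cast hn
  set l : ℝ := a / n with hl
  have hl0 : 0 < l := by positivity
  have h1 : ((Finset.univ.filter fun σ : Fin n → Bool => a < ∑ i, sg (σ i) * c i).card : ℝ)
      * Real.exp (l * a) ≤ ∑ σ : Fin n → Bool, Real.exp (l * ∑ i, sg (σ i) * c i) := by
    rw [← nsmul_eq_mul]
    refine (Finset.card_nsmul_le_sum _ (fun σ => Real.exp (l * ∑ i, sg (σ i) * c i)) _ ?_).trans ?_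
    · intro σ hσ
      simp only [Finset.mem_filter, Finset.mem_univ, true_and] at hσ
      exact Real.exp_le_exp.2 (mul_le_mul_of_nonneg_left hσ.le hl0.le)
    · exact Finset.sum_le_sum_of_subset_of_nonneg (Finset.filter_subset _ _)
        (fun _ _ _ => (Real.exp_pos _).le)
  have h2 : ∑ σ : Fin n → Bool, Real.exp (l * ∑ i, sg (σ i) * c i)
      = ∏ i : Fin n, ∑ b : Bool, Real.exp (l * (sg b * c i)) := by
    rw [Fintype.prod_sum]
    refine Finset.sum_congr rfl fun σ _ => ?_
    rw [Finset.mul_sum, Real.exp_sum]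
  have h3 : ∏ i : Fin n, ∑ b : Bool, Real.exp (l * (sg b * c i))
      ≤ ∏ _i : Fin n, (2 * Real.exp (l ^ 2 / 2)) := by
    refine Finset.prod_le_prod (fun i _ => Finset.sum_nonneg fun _ _ => (Real.exp_pos _).le) ?_
    intro i _
    have : ∑ b : Bool, Real.exp (l * (sg b * c i)) = 2 * Real.cosh (l * c i) := by
      simp [sg, Real.cosh_eq]; ring
    rw [this]
    have h4 := Real.cosh_le_exp_half_sq (l * c i)
    have h5 : (l * c i) ^ 2 / 2 ≤ l ^ 2 / 2 := by
      have : (c i) ^ 2 ≤ 1 := by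
        rw [← sq_abs]; have := hc i; have := abs_nonneg (c i); nlinarith
      rw [mul_pow]; nlinarith [sq_nonneg l]
    have := Real.exp_le_exp.2 h5
    linarith
  rw [h2] at h1
  have h6 := h1.trans h3
  rw [Finset.prod_const, Finset.card_univ, Fintype.card_fin, mul_pow, ← Real.exp_nat_mul] at h6
  have h7 : Real.exp (-(a ^ 2 / (2 * n))) = Real.exp (n * (l ^ 2 / 2)) * Real.exp (-(l * a)) := by
    rw [← Real.exp_add]; congr 1; rw [hl]; field_simp; ring
  rw [h7, ← mul_assoc]
  rw [Real.exp_neg, ← div_eq_mul_inv, le_div_iff₀ (Real.exp_pos _)]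
  exact h6

open Classical in
lemma rad_two (n : ℕ) (hn : 1 ≤ n) (c : Fin n → ℝ) (hc : ∀ i, |c i| ≤ 1) (a : ℝ) (ha : 0 < a) :
    ((Finset.univ.filter fun σ : Fin n → Bool => a < |∑ i, sg (σ i) * c i|).card : ℝ)
      ≤ 2 * (2 ^ n * Real.exp (-(a ^ 2 / (2 * n)))) := by
  have h1 := rad_one n hn c hc a ha
  have h2 := rad_one n hn (fun i => - c i) (fun i => by simpa using hc i) a ha
  have h3 : (Finset.univ.filter fun σ : Fin n → Bool => a < |∑ i, sg (σ i) * c i|) ⊆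
     (Finset.univ.filter fun σ : Fin n → Bool => a < ∑ i, sg (σ i) * c i) ∪
     (Finset.univ.filter fun σ : Fin n → Bool => a < ∑ i, sg (σ i) * (- c i)) := by
    intro σ
    simp only [Finset.mem_filter, Finset.mem_union, Finset.mem_univ, true_and, mul_neg,
      Finset.sum_neg_distrib, lt_abs]
    exact id
  have h4 : ((Finset.univ.filter fun σ : Fin n → Bool => a < |∑ i, sg (σ i) * c i|).card : ℝ) ≤
     (Finset.univ.filter fun σ : Fin n → Bool => a < ∑ i, sg (σ i) * c i).card +
     (Finset.univ.filter fun σ : Fin n → Bool => a < ∑ i, sg (σ i) * (- c i)).card := by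
    exact_mod_cast (Finset.card_le_card h3).trans (Finset.card_union_le _ _)
  linarith

/-- coordinatewise swap -/
def swp {Ω : Type*} {n : ℕ} (σ : Fin n → Bool) (x : Fin n → Ω × Ω) : Fin n → Ω × Ω :=
  fun i => if σ i then x i else (x i).swap

lemma swp_mp {Ω : Type*} [MeasurableSpace Ω] (D : Measure Ω) [IsProbabilityMeasure D] {n : ℕ}
    (σ : Fin n → Bool) : MeasurePreserving (swp (Ω := Ω) σ)
      (Measure.pi fun _ : Fin n => D.prod D) (Measure.pi fun _ : Fin n => D.prod D) := by
  refine measurePreserving_pi (fun _ : Fin n => D.prod D) (fun _ : Fin n => D.prod D)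
    (f := fun i z => if σ i then z else z.swap) ?_
  intro i
  cases σ i
  · simpa using Measure.measurePreserving_swap
  · simpa using! MeasurePreserving.id (D.prod D)

open Classical in
lemma avg_bound {Ω : Type*} [MeasurableSpace Ω] (D : Measure Ω) [IsProbabilityMeasure D] {n : ℕ}
    (A : Set (Fin n → Ω × Ω)) (hA : MeasurableSet A) (N : ℝ)
    (h : ∀ x, ((Finset.univ.filter fun σ : Fin n → Bool => swp σ x ∈ A).card : ℝ) ≤ 2 ^ n * N) :
    (Measure.pi fun _ : Fin n => D.prod D) A ≤ ENNReal.ofReal N := by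
  set ν := (Measure.pi fun _ : Fin n => D.prod D) with hν
  have h1 : ∑ σ : Fin n → Bool, ν (swp σ ⁻¹' A) = 2 ^ n * ν A := by
    rw [Finset.sum_congr rfl (fun σ _ => (swp_mp D σ).measure_preimage hA.nullMeasurableSet)]
    simp [hν]
  have h2 : ∑ σ : Fin n → Bool, ν (swp σ ⁻¹' A)
      = ∫⁻ x, ∑ σ : Fin n → Bool, (swp σ ⁻¹' A).indicator 1 x ∂ν := by
    rw [lintegral_finsetSum]
    · refine Finset.sum_congr rfl fun σ _ => ?_
      rw [lintegral_indicator_one ((swp_mp D σ).measurable hA)]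
    · intro σ _
      exact measurable_one.indicator ((swp_mp D σ).measurable hA)
  have h3 : ∫⁻ x, ∑ σ : Fin n → Bool, (swp σ ⁻¹' A).indicator 1 x ∂ν
      ≤ ∫⁻ _x, ENNReal.ofReal (2 ^ n * N) ∂ν := by
    refine lintegral_mono fun x => ?_
    have : ∑ σ : Fin n → Bool, (swp σ ⁻¹' A).indicator (1 : (Fin n → Ω × Ω) → ENNReal) x
        = ((Finset.univ.filter fun σ : Fin n → Bool => swp σ x ∈ A).card : ENNReal) := by
      rw [Finset.card_filter]
      push_cast
      refine Finset.sum_congr rfl fun σ _ => ?_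
      simp [Set.indicator_apply]
    rw [this, ← ENNReal.ofReal_natCast]
    exact ENNReal.ofReal_le_ofReal (h x)
  rw [← h2, h1, lintegral_const, hν, measure_univ, mul_one, ENNReal.ofReal_mul (by positivity)] at h3
  have h4 : ENNReal.ofReal (2 ^ n) = 2 ^ n := by
    rw [ENNReal.ofReal_pow (by norm_num)]; simp
  rw [h4] at h3
  exact (ENNReal.mul_le_mul_iff_right (by simp) (by simp)).1 h3

open Classical in
lemma pair_bound {Ω Q : Type*} [MeasurableSpace Ω] (D : Measure Ω) [IsProbabilityMeasure D] {n : ℕ}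
    (hn : 1 ≤ n) (L : Q → Ω → ℝ) (h0 : ∀ q z, 0 ≤ L q z) (h1 : ∀ q z, L q z ≤ 1)
    (T : ℝ) (hT : 0 < T) (Γ : ℕ)
    (hA : MeasurableSet {x : Fin n → Ω × Ω | ∃ q, T / 2 < |∑ i, (L q (x i).1 - L q (x i).2)|})
    (hΓ : ∀ x : Fin n → Ω × Ω, ∃ S : Finset (Fin n → ℝ), S.card ≤ Γ ∧
      ∀ q, (fun i => L q (x i).1 - L q (x i).2) ∈ S) :
    (Measure.pi fun _ : Fin n => D.prod D)
      {x : Fin n → Ω × Ω | ∃ q, T / 2 < |∑ i, (L q (x i).1 - L q (x i).2)|}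
      ≤ ENNReal.ofReal (Γ * (2 * Real.exp (-(T ^ 2 / (8 * n))))) := by
  refine avg_bound D _ hA _ fun x => ?_
  obtain ⟨S, hS, hq⟩ := hΓ x
  set S' := S.filter fun c => ∀ i, |c i| ≤ 1 with hS'
  have hsub : (Finset.univ.filter fun σ : Fin n → Bool => swp σ x ∈
      {x : Fin n → Ω × Ω | ∃ q, T / 2 < |∑ i, (L q (x i).1 - L q (x i).2)|}) ⊆
      S'.biUnion fun c => Finset.univ.filter fun σ : Fin n → Bool =>
        T / 2 < |∑ i, sg (σ i) * c i| := by
    intro σ hσ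
    simp only [Set.mem_ofPred_eq, Finset.mem_filter, Finset.mem_univ, true_and] at hσ
    obtain ⟨q, hq'⟩ := hσ
    simp only [Finset.mem_biUnion, Finset.mem_filter, Finset.mem_univ, true_and, hS']
    refine ⟨_, ⟨hq q, ?_⟩, ?_⟩
    · intro i
      rw [abs_le]
      have := h0 q (x i).1
      have := h0 q (x i).2
      have := h1 q (x i).1
      have := h1 q (x i).2
      constructor <;> linarith
    · have : ∑ i, sg (σ i) * (L q (x i).1 - L q (x i).2)
          = ∑ i, (L q (swp σ x i).1 - L q (swp σ x i).2) := by
        refine Finset.sum_congr rfl fun i _ => ?_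
        unfold swp sg
        cases σ i <;> simp
      rw [this]
      exact hq'
  have hcard : ((Finset.univ.filter fun σ : Fin n → Bool => swp σ x ∈
      {x : Fin n → Ω × Ω | ∃ q, T / 2 < |∑ i, (L q (x i).1 - L q (x i).2)|}).card : ℝ) ≤
      ∑ c ∈ S', ((Finset.univ.filter fun σ : Fin n → Bool =>
        T / 2 < |∑ i, sg (σ i) * c i|).card : ℝ) := by
    exact_mod_cast (Finset.card_le_card hsub).trans Finset.card_biUnion_le
  refine hcard.trans ?_
  have hb : ∀ c ∈ S', ((Finset.univ.filter fun σ : Fin n → Bool =>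
        T / 2 < |∑ i, sg (σ i) * c i|).card : ℝ) ≤
        2 * (2 ^ n * Real.exp (-(T ^ 2 / (8 * n)))) := by
    intro c hc
    have := rad_two n hn c (Finset.mem_filter.1 hc).2 (T / 2) (by positivity)
    convert this using 4
    have hn0 : (0 : ℝ) < n := by exact_mod_cast hn
    field_simp
    norm_num
  refine (Finset.sum_le_card_nsmul _ _ _ hb).trans ?_
  rw [nsmul_eq_mul]
  have : (S'.card : ℝ) ≤ Γ := by exact_mod_cast (Finset.card_filter_le _ _).trans hS
  calc (S'.card : ℝ) * (2 * (2 ^ n * Real.exp (-(T ^ 2 / (8 * n)))))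
      ≤ Γ * (2 * (2 ^ n * Real.exp (-(T ^ 2 / (8 * n))))) := by gcongr
    _ = _ := by ring

open ProbabilityTheory in
lemma cheb {Ω : Type*} [MeasurableSpace Ω] (D : Measure Ω) [IsProbabilityMeasure D] {n : ℕ}
    (f : Ω → ℝ) (hf : Measurable f) (h0 : ∀ z, 0 ≤ f z) (h1 : ∀ z, f z ≤ 1)
    (T : ℝ) (hT : 0 < T) (hnT : 2 * n ≤ T ^ 2) :
    (Measure.pi fun _ : Fin n => D) {s | T / 2 ≤ |∑ i, f (s i) - n * ∫ z, f z ∂D|}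
      ≤ ENNReal.ofReal (1 / 2) := by
  have hb : ∀ z, f z ∈ Set.Icc (0 : ℝ) 1 := fun z => ⟨h0 z, h1 z⟩
  have hm : MemLp f 2 D := memLp_of_bounded (.of_forall hb) hf.aestronglyMeasurable 2
  have hv := variance_sum_pi (μ := fun _ : Fin n => D) (X := fun _ => f) (fun _ => hm)
  have hv1 : Var[f; D] ≤ 1 / 4 := by
    have := variance_le_sq_of_bounded (μ := D) (.of_forall hb) hf.aemeasurable
    norm_num at this ⊢; exact this
  set X : (Fin n → Ω) → ℝ := ∑ i, fun ω ↦ f (ω i) with hX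
  have hi : ∀ i : Fin n, MemLp (fun ω : Fin n → Ω => f (ω i)) 2 (Measure.pi fun _ : Fin n => D) :=
    fun i => hm.comp_measurePreserving (measurePreserving_eval (fun _ : Fin n => D) i)
  have hXm : MemLp X 2 (Measure.pi fun _ : Fin n => D) := by
    rw [hX]
    exact memLp_finsetSum' _ fun i _ => hi i
  have hE : ∫ s, X s ∂(Measure.pi fun _ : Fin n => D) = n * ∫ z, f z ∂D := by
    simp only [hX, Finset.sum_apply]
    rw [integral_finsetSum _ fun i _ => (hi i).integrable (by norm_num)]
    have : ∀ i : Fin n, ∫ a : Fin n → Ω, f (a i) ∂(Measure.pi fun _ : Fin n => D) = ∫ z, f z ∂D := by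
      intro i
      have := (measurePreserving_eval (fun _ : Fin n => D) i)
      have h5 := integral_map (μ := Measure.pi fun _ : Fin n => D) this.measurable.aemeasurable
        (hf.aestronglyMeasurable (μ := Measure.map (Function.eval i) (Measure.pi fun _ : Fin n => D)))
      rw [this.map_eq] at h5
      exact h5.symm
    simp [this]
  have := meas_ge_le_variance_div_sq hXm (c := T / 2) (by positivity)
  rw [hE] at this
  have hX' : ∀ s, X s = ∑ i, f (s i) := fun s => by simp [hX]
  simp only [hX'] at this
  refine this.trans (ENNReal.ofReal_le_ofReal ?_)
  rw [hv, Finset.sum_const, Finset.card_univ, Fintype.card_fin, nsmul_eq_mul,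
    div_le_iff₀ (by positivity)]
  have : (n : ℝ) * Var[f; D] ≤ n * (1 / 4) := by gcongr
  nlinarith

theorem symm_bound {Ω Q : Type*} [MeasurableSpace Ω] (D : Measure Ω) [IsProbabilityMeasure D]
    {n : ℕ} (hn : 1 ≤ n) (L : Q → Ω → ℝ) (h0 : ∀ q z, 0 ≤ L q z) (h1 : ∀ q z, L q z ≤ 1)
    (hL : ∀ q, Measurable (L q))
    (T : ℝ) (hT : 0 < T) (hnT : 2 * n ≤ T ^ 2) (Γ : ℕ)
    (hA : MeasurableSet {x : Fin n → Ω × Ω | ∃ q, T / 2 < |∑ i, (L q (x i).1 - L q (x i).2)|})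
    (hΓ : ∀ x : Fin n → Ω × Ω, ∃ S : Finset (Fin n → ℝ), S.card ≤ Γ ∧
      ∀ q, (fun i => L q (x i).1 - L q (x i).2) ∈ S) :
    (Measure.pi fun _ : Fin n => D) {s | ∃ q, T < |∑ i, L q (s i) - n * ∫ z, L q z ∂D|}
      ≤ ENNReal.ofReal (4 * Γ * Real.exp (-(T ^ 2 / (8 * n)))) := by
  set μ := (Measure.pi fun _ : Fin n => D) with hμ
  have hp := pair_bound D hn L h0 h1 T hT Γ hA hΓ
  set A := {x : Fin n → Ω × Ω | ∃ q, T / 2 < |∑ i, (L q (x i).1 - L q (x i).2)|} with hAdef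
  set e := MeasurableEquiv.arrowProdEquivProdArrow Ω Ω (Fin n) with he
  have hmp := measurePreserving_arrowProdEquivProdArrow Ω Ω (Fin n) (fun _ => D) (fun _ => D)
  set A' : Set ((Fin n → Ω) × (Fin n → Ω)) := e.symm ⁻¹' A with hA'
  have hA'm : MeasurableSet A' := e.symm.measurable hA
  have hA'v : (μ.prod μ) A' = (Measure.pi fun _ : Fin n => D.prod D) A := by
    rw [← hmp.measure_preimage hA'm.nullMeasurableSet]
    congr 1
  rw [Measure.prod_apply hA'm] at hA'v
  have hmeas := measurable_measure_prodMk_left (ν := μ) hA'm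
  have hmark := mul_meas_ge_le_lintegral (μ := μ) hmeas (1 / 2)
  rw [hA'v] at hmark
  have hsub : {s | ∃ q, T < |∑ i, L q (s i) - n * ∫ z, L q z ∂D|} ⊆
      {s | 1 / 2 ≤ μ (Prod.mk s ⁻¹' A')} := by
    rintro s ⟨q, hq⟩
    have hc := cheb D (n := n) (L q) (hL q) (h0 q) (h1 q) T hT hnT
    set E := {s : Fin n → Ω | T / 2 ≤ |∑ i, L q (s i) - n * ∫ z, L q z ∂D|} with hE
    have hEs : Eᶜ ⊆ Prod.mk s ⁻¹' A' := by
      intro s' hs'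
      simp only [hE, Set.mem_compl_iff, Set.mem_ofPred_eq, not_le] at hs'
      change ∃ q, T / 2 < |∑ i, (L q (s i) - L q (s' i))|
      refine ⟨q, ?_⟩
      rw [Finset.sum_sub_distrib]
      have := abs_sub_abs_le_abs_sub (∑ i, L q (s i) - n * ∫ z, L q z ∂D)
        (∑ i, L q (s' i) - n * ∫ z, L q z ∂D)
      rw [sub_sub_sub_cancel_right] at this
      linarith
    have hEm : MeasurableSet E := by
      have : Measurable fun s : Fin n → Ω => |∑ i, L q (s i) - n * ∫ z, L q z ∂D| := by
        have : Measurable fun s : Fin n → Ω => ∑ i, L q (s i) :=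
          Finset.measurable_fun_sum _ fun i _ => (hL q).comp (measurable_pi_apply i)
        exact (this.sub_const _).abs
      exact measurableSet_le measurable_const this
    have h2 : 1 / 2 ≤ μ Eᶜ := by
      rw [prob_compl_eq_one_sub hEm]
      have : (1 / 2 : ENNReal) = 1 - ENNReal.ofReal (1 / 2) := by
        rw [← ENNReal.ofReal_one, ← ENNReal.ofReal_sub _ (by norm_num)]
        rw [show (1 : ℝ) - 1 / 2 = 2⁻¹ by norm_num, ENNReal.ofReal_inv_of_pos (by norm_num)]
        simp
      rw [this]
      exact tsub_le_tsub_left hc 1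
    exact h2.trans (measure_mono hEs)
  refine (measure_mono hsub).trans ?_
  have h3 : μ {s | 1 / 2 ≤ μ (Prod.mk s ⁻¹' A')} ≤
      2 * (Measure.pi fun _ : Fin n => D.prod D) A := by
    calc μ {s | 1 / 2 ≤ μ (Prod.mk s ⁻¹' A')} = 2 * (1 / 2 * μ {s | 1 / 2 ≤ μ (Prod.mk s ⁻¹' A')}) := by
          rw [← mul_assoc, one_div, ENNReal.mul_inv_cancel (by simp) (by simp), one_mul]
      _ ≤ _ := by gcongr
  refine (h3.trans (mul_le_mul_right hp 2)).trans ?_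
  rw [show (2 : ENNReal) = ENNReal.ofReal 2 by simp, ← ENNReal.ofReal_mul (by norm_num)]
  apply ENNReal.ofReal_le_ofReal
  apply le_of_eq
  ring


/-- exponential sums with at most `K` terms -/
def ES (K : ℕ) (f : ℝ → ℝ) : Prop :=
  ∃ (ι : Type) (_ : Fintype ι) (c l : ι → ℝ), Fintype.card ι ≤ K ∧
    ∀ p, f p = ∑ k, c k * Real.exp (l k * p)

lemma ES.mono {K K' : ℕ} {f : ℝ → ℝ} (h : ES K f) (hK : K ≤ K') : ES K' f := by
  obtain ⟨ι, i, c, l, h1, h2⟩ := h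
  exact ⟨ι, i, c, l, h1.trans hK, h2⟩

lemma ES.const (a : ℝ) : ES 1 (fun _ => a) :=
  ⟨Unit, inferInstance, fun _ => a, fun _ => 0, by simp, by simp⟩

lemma ES.exp (l : ℝ) : ES 1 (fun p => Real.exp (l * p)) :=
  ⟨Unit, inferInstance, fun _ => 1, fun _ => l, by simp, by simp⟩

lemma ES.mul {K K' : ℕ} {f g : ℝ → ℝ} (hf : ES K f) (hg : ES K' g) :
    ES (K * K') (fun p => f p * g p) := by
  obtain ⟨ι, i, c, l, h1, h2⟩ := hf
  obtain ⟨ι', i', c', l', h1', h2'⟩ := hg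
  refine ⟨ι × ι', inferInstance, fun k => c k.1 * c' k.2, fun k => l k.1 + l' k.2, ?_, ?_⟩
  · rw [Fintype.card_prod]; exact Nat.mul_le_mul h1 h1'
  · intro p
    beta_reduce
    rw [h2, h2', Finset.sum_mul_sum, ← Finset.univ_product_univ, Finset.sum_product]
    refine Finset.sum_congr rfl fun a _ => Finset.sum_congr rfl fun b _ => ?_
    rw [add_mul, Real.exp_add]; ring

lemma ES.cmul {K : ℕ} {f : ℝ → ℝ} (a : ℝ) (hf : ES K f) : ES K (fun p => a * f p) := by
  simpa using (ES.const a).mul hf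

lemma ES.sum {J : Type} [Fintype J] {K : ℕ} {f : J → ℝ → ℝ} (hf : ∀ j, ES K (f j)) :
    ES (Fintype.card J * K) (fun p => ∑ j, f j p) := by
  choose ι i c l h1 h2 using hf
  refine ⟨Σ j, ι j, inferInstance, fun k => c k.1 k.2, fun k => l k.1 k.2, ?_, ?_⟩
  · rw [Fintype.card_sigma]
    refine (Finset.sum_le_card_nsmul _ _ K fun j _ => h1 j).trans ?_
    simp
  · intro p
    rw [Fintype.sum_sigma]
    exact Finset.sum_congr rfl fun j _ => h2 j p

lemma ES.add {K K' : ℕ} {f g : ℝ → ℝ} (hf : ES K f) (hg : ES K' g) :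
    ES (K + K') (fun p => f p + g p) := by
  obtain ⟨ι, i, c, l, h1, h2⟩ := hf
  obtain ⟨ι', i', c', l', h1', h2'⟩ := hg
  refine ⟨ι ⊕ ι', inferInstance, Sum.elim c c', Sum.elim l l', ?_, ?_⟩
  · rw [Fintype.card_sum]; exact Nat.add_le_add h1 h1'
  · intro p
    simp [h2, h2']

lemma ES.prod {J : Type} {K : ℕ} {f : J → ℝ → ℝ} (s : Finset J)
    (hf : ∀ j, ES K (f j)) : ES (K ^ s.card) (fun p => ∏ j ∈ s, f j p) := by
  classical
  induction s using Finset.induction_on with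
  | empty => simpa using ES.const 1
  | insert a s ha ih =>
    rw [Finset.card_insert_of_notMem ha, pow_succ']
    simp only [Finset.prod_insert ha]
    exact (hf a).mul ih

lemma ES.det {d K : ℕ} {M : ℝ → Matrix (Fin d) (Fin d) ℝ} (h : ∀ i j, ES K (fun p => M p i j)) :
    ES (d.factorial * K ^ d) (fun p => (M p).det) := by
  simp only [Matrix.det_apply']
  have := ES.sum (J := Equiv.Perm (Fin d)) (K := K ^ d)
    (f := fun σ p => ((Equiv.Perm.sign σ : ℤ) : ℝ) * ∏ i, M p (σ i) i) (fun σ => ?_)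
  · rwa [Fintype.card_perm, Fintype.card_fin] at this
  · refine ES.cmul _ ?_
    simpa using ES.prod Finset.univ (f := fun i p => M p (σ i) i) (fun i => h _ _)

/-- Rolle: zeros of `f` versus zeros of the derivative. -/
lemma rolle_count (f f' : ℝ → ℝ) (hf : ∀ x, HasDerivAt f (f' x) x) (k : ℕ)
    (h : ∀ Z : Finset ℝ, (∀ z ∈ Z, f' z = 0) → Z.card ≤ k) :
    ∀ Z : Finset ℝ, (∀ z ∈ Z, f z = 0) → Z.card ≤ k + 1 := by
  intro Z hZ
  by_contra hcon
  push Not at hcon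
  obtain ⟨Z', hZ', hc⟩ := Finset.exists_subset_card_eq (show k + 2 ≤ Z.card by omega)
  set e := Z'.orderEmbOfFin hc with he
  have hz : ∀ i, f (e i) = 0 := fun i => hZ _ (hZ' (Finset.orderEmbOfFin_mem _ _ _))
  have hex : ∀ i : Fin (k + 1), ∃ c ∈ Set.Ioo (e i.castSucc) (e i.succ), f' c = 0 := by
    intro i
    refine exists_hasDerivAt_eq_zero (e.strictMono (Fin.castSucc_lt_succ)) ?_
      ((hz _).trans (hz _).symm) (fun x _ => hf x)
    exact fun x _ => (hf x).continuousAt.continuousWithinAt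
  choose c hc1 hc2 using hex
  have hmono : StrictMono c := by
    intro i j hij
    refine (hc1 i).2.trans_le (le_trans ?_ (hc1 j).1.le)
    exact e.monotone (by rw [Fin.le_def]; simp; exact hij)
  have := h (Finset.univ.map ⟨c, hmono.injective⟩) (by simpa using hc2)
  simp at this

lemma expsum_zeros {ι : Type} (s : Finset ι) : ∀ (c l : ι → ℝ),
    (∀ p, ∑ k ∈ s, c k * Real.exp (l k * p) = 0) ∨
    ∀ Z : Finset ℝ, (∀ p ∈ Z, ∑ k ∈ s, c k * Real.exp (l k * p) = 0) → Z.card ≤ s.card := by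
  classical
  induction s using Finset.induction_on with
  | empty => intro c l; left; simp
  | insert a s ha ih =>
    intro c l
    set g : ℝ → ℝ := fun p => c a + ∑ k ∈ s, c k * Real.exp ((l k - l a) * p) with hg
    set g' : ℝ → ℝ := fun p => ∑ k ∈ s, (c k * (l k - l a)) * Real.exp ((l k - l a) * p) with hg'
    have hfg : ∀ p, ∑ k ∈ insert a s, c k * Real.exp (l k * p) = Real.exp (l a * p) * g p := by
      intro p
      rw [Finset.sum_insert ha, hg]
      simp only [mul_add, Finset.mul_sum]
      congr 1
      · ring
      · refine Finset.sum_congr rfl fun k _ => ?_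
        rw [show l k * p = l a * p + (l k - l a) * p by ring, Real.exp_add]; ring
    have hzero : ∀ p, ∑ k ∈ insert a s, c k * Real.exp (l k * p) = 0 ↔ g p = 0 := by
      intro p; rw [hfg]; simp [Real.exp_ne_zero]
    have hd : ∀ x, HasDerivAt g (g' x) x := by
      intro x
      rw [hg, hg']
      refine HasDerivAt.const_add _ ?_
      refine HasDerivAt.fun_sum fun k _ => ?_
      have h1 : HasDerivAt (fun p : ℝ => (l k - l a) * p) (l k - l a) x := by
        simpa using (hasDerivAt_id x).const_mul (l k - l a)
      have := (h1.exp).const_mul (c k)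
      refine this.congr_deriv ?_
      ring
    simp only [hzero]
    rcases ih (fun k => c k * (l k - l a)) (fun k => l k - l a) with h | h
    · have hconst : ∀ x y, g x = g y := by
        refine is_const_of_deriv_eq_zero (fun x => (hd x).differentiableAt) (fun x => ?_)
        rw [(hd x).deriv]; exact h x
      by_cases h0 : g 0 = 0
      · left; intro p; rw [hconst p 0, h0]
      · right; intro Z hZ
        have : Z = ∅ := by
          rw [Finset.eq_empty_iff_forall_notMem]
          intro z hz
          exact h0 ((hconst 0 z).trans (hZ z hz))
        simp [this]
    · right
      rw [Finset.card_insert_of_notMem ha]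
      exact rolle_count g g' hd _ h

lemma ES.zeros {K : ℕ} {f : ℝ → ℝ} (hf : ES K f) :
    ∃ Z : Finset ℝ, Z.card ≤ K ∧ ((∀ p, f p = 0) ∨ ∀ p, f p = 0 → p ∈ Z) := by
  obtain ⟨ι, i, c, l, h1, h2⟩ := hf
  rcases expsum_zeros Finset.univ c l with h | h
  · exact ⟨∅, by simp, Or.inl fun p => (h2 p).trans (h p)⟩
  · have hfin : {p | f p = 0}.Finite := by
      by_contra hinf
      obtain ⟨t, ht, hc⟩ := Set.Infinite.exists_subset_card_eq hinf (K + 1)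
      have := h t (fun p hp => by rw [← h2]; exact ht hp)
      rw [hc, Finset.card_univ] at this
      omega
    refine ⟨hfin.toFinset, ?_, Or.inr fun p hp => by simpa using hp⟩
    refine (h hfin.toFinset ?_).trans h1
    intro p hp
    rw [← h2]
    simpa using hp

lemma ES.continuous {K : ℕ} {f : ℝ → ℝ} (hf : ES K f) : Continuous f := by
  obtain ⟨ι, i, c, l, h1, h2⟩ := hf
  rw [show f = fun p => ∑ k, c k * Real.exp (l k * p) from funext h2]
  fun_prop

/-- patterns of a one-parameter family of exponential sums -/
lemma one_param {m K : ℕ} (F : Fin m → ℝ → ℝ) (hF : ∀ j, ES K (F j)) :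
    ∃ P : Finset (Fin m → Prop), P.card ≤ 2 * (m * K + 1) ∧
      ∀ p, (fun j => 0 ≤ F j p) ∈ P := by
  classical
  choose Z hZ1 hZ2 using fun j => (hF j).zeros
  set W := Finset.univ.biUnion Z with hW
  have hWc : W.card ≤ m * K := by
    refine (Finset.card_biUnion_le).trans ?_
    refine (Finset.sum_le_card_nsmul _ _ K fun j _ => hZ1 j).trans ?_
    simp
  set key : ℝ → Fin (m * K + 1) × Bool := fun p =>
    (⟨(W.filter (· < p)).card, by
      have := Finset.card_filter_le W (· < p); omega⟩, decide (p ∈ W)) with hkey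
  have hinj : ∀ p p', p ≤ p' → key p = key p' → (fun j => 0 ≤ F j p) = fun j => 0 ≤ F j p' := by
    intro p p' hpp hk
    rcases hpp.eq_or_lt with rfl | hlt
    · rfl
    simp only [hkey, Prod.mk.injEq, Fin.mk.injEq, decide_eq_decide] at hk
    obtain ⟨hk1, hk2⟩ := hk
    have hsub : W.filter (· < p) ⊆ W.filter (· < p') := by
      intro z; simp only [Finset.mem_filter]; exact fun h => ⟨h.1, h.2.trans hlt⟩
    have heq := Finset.eq_of_subset_of_card_le hsub hk1.ge
    have hno : ∀ z ∈ W, ¬ (p ≤ z ∧ z < p') := by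
      rintro z hz ⟨h1, h2⟩
      have : z ∈ W.filter (· < p') := by simp [hz, h2]
      rw [← heq] at this
      simp at this
      linarith [this.2]
    have hp : p ∉ W := fun h => hno p h ⟨le_rfl, hlt⟩
    have hp' : p' ∉ W := fun h => hp (hk2.2 h)
    have hno' : ∀ z ∈ Set.Icc p p', z ∉ W := by
      intro z hz hzW
      rcases hz.2.eq_or_lt with rfl | h
      · exact hp' hzW
      · exact hno z hzW ⟨hz.1, h⟩
    funext j
    rcases hZ2 j with h | h
    · simp [h]
    · have hne : ∀ z ∈ Set.Icc p p', F j z ≠ 0 := fun z hz h0 =>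
        hno' z hz (by rw [hW]; exact Finset.mem_biUnion.2 ⟨j, Finset.mem_univ _, h z h0⟩)
      have hcont : ContinuousOn (F j) (Set.Icc p p') := (hF j).continuous.continuousOn
      apply propext
      constructor
      · intro h0
        by_contra hneg
        push Not at hneg
        obtain ⟨z, hz, hz0⟩ := intermediate_value_Icc' hpp hcont ⟨hneg.le, h0⟩
        exact hne z hz hz0
      · intro h0
        by_contra hneg
        push Not at hneg
        obtain ⟨z, hz, hz0⟩ := intermediate_value_Icc hpp hcont ⟨hneg.le, h0⟩
        exact hne z hz hz0
  have hinj' : ∀ p p', key p = key p' → (fun j => 0 ≤ F j p) = fun j => 0 ≤ F j p' := by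
    intro p p' h
    rcases le_total p p' with h1 | h1
    · exact hinj p p' h1 h
    · exact (hinj p' p h1 h.symm).symm
  refine ⟨Finset.univ.image fun k : Fin (m * K + 1) × Bool =>
    if h : ∃ p, key p = k then (fun j => 0 ≤ F j h.choose) else fun _ => True, ?_, ?_⟩
  · refine Finset.card_image_le.trans ?_
    simp [mul_comm]
  · intro p
    rw [Finset.mem_image]
    refine ⟨key p, Finset.mem_univ _, ?_⟩
    have h : ∃ p', key p' = key p := ⟨p, rfl⟩
    rw [dif_pos h]
    exact hinj' _ _ h.choose_spec


/-- A nonempty polyhedron contains the solution set of a full-rank system of tight constraints,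
completed by coordinate equations. -/
lemma poly {d m : ℕ} (a : Fin m → Fin d → ℝ) (b : Fin m → ℝ) (w0 : Fin d → ℝ)
    (h0 : ∀ j, b j ≤ a j ⬝ᵥ w0) :
    ∃ φ : Fin d → Fin m ⊕ Fin d,
      (∀ x : Fin d → ℝ, (∀ k, Sum.elim a (fun i => Pi.single i 1) (φ k) ⬝ᵥ x = 0) → x = 0) ∧
      ∀ x : Fin d → ℝ, (∀ k, Sum.elim a (fun i => Pi.single i 1) (φ k) ⬝ᵥ x
        = Sum.elim b (fun _ => 0) (φ k)) → ∀ j, b j ≤ a j ⬝ᵥ x := by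
  classical
  set tight : (Fin d → ℝ) → Finset (Fin m) := fun w => Finset.univ.filter fun j => a j ⬝ᵥ w = b j
    with htight
  have htm : ∀ w, (tight w).card ≤ m := fun w => by
    simpa using Finset.card_le_univ (tight w)
  obtain ⟨w, hw, hmax⟩ := (InvImage.wf (fun w => m - (tight w).card) Nat.lt_wfRel.wf).has_min
    {w | ∀ j, b j ≤ a j ⬝ᵥ w} ⟨w0, h0⟩
  have hmax' : ∀ w', (∀ j, b j ≤ a j ⬝ᵥ w') → (tight w').card ≤ (tight w).card := by
    intro w' hw'
    have h1 : ¬ (m - (tight w').card < m - (tight w).card) := hmax w' hw'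
    have := htm w
    have := htm w'
    omega
  change ∀ j, b j ≤ a j ⬝ᵥ w at hw
  set v : Fin m ⊕ Fin d → Fin d → ℝ := Sum.elim a (fun i => Pi.single i 1) with hv
  set Tt : Set (Fin m ⊕ Fin d) := Sum.inl '' (tight w : Set (Fin m)) with hTt
  obtain ⟨b0, hb0T, -, hb0s, hb0li⟩ :=
    exists_linearIndepOn_extension (K := ℝ) (v := v) (linearIndepOn_empty ℝ v)
      (Set.empty_subset Tt)
  obtain ⟨b1, hb1T, hb01, hb1s, hb1li⟩ :=
    exists_linearIndepOn_extension hb0li (Set.subset_union_left (t := Set.range Sum.inr))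
  have hspan : Submodule.span ℝ (v '' b1) = ⊤ := by
    rw [eq_top_iff]
    intro x _
    have : x = ∑ i, x i • (Pi.single i 1 : Fin d → ℝ) := by
      ext j
      simp [Finset.sum_apply, Pi.single_apply]
    rw [this]
    refine Submodule.sum_mem _ fun i _ => Submodule.smul_mem _ _ (hb1s ?_)
    exact ⟨Sum.inr i, Or.inr ⟨i, rfl⟩, by simp [hv]⟩
  have hli : LinearIndependent ℝ (fun k : b1 => v k) := hb1li
  let B : Module.Basis b1 ℝ (Fin d → ℝ) := Module.Basis.mk hli (by
    rw [← Set.image_eq_range, hspan])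
  have hcard : Fintype.card b1 = d := by
    have := Module.finrank_eq_card_basis B
    rw [Module.finrank_fin_fun] at this
    exact this.symm
  let e : Fin d ≃ b1 := (Fintype.equivFinOfCardEq hcard).symm
  refine ⟨fun k => (e k : Fin m ⊕ Fin d), ?_, ?_⟩
  · intro x hx
    have h1 : ∀ y ∈ Submodule.span ℝ (v '' b1), y ⬝ᵥ x = 0 := by
      intro y hy
      induction hy using Submodule.span_induction with
      | mem y hy =>
        obtain ⟨k, hk, rfl⟩ := hy
        have := hx (e.symm ⟨k, hk⟩)
        simpa using this
      | zero => simp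
      | add y z _ _ h1 h2 => rw [add_dotProduct, h1, h2, add_zero]
      | smul r y _ h1 => rw [smul_dotProduct, h1, smul_zero]
    rw [hspan] at h1
    funext i
    simpa using h1 (Pi.single i 1) trivial
  · intro w' hw'
    have h1 : ∀ y ∈ Submodule.span ℝ (v '' b0), y ⬝ᵥ w' = y ⬝ᵥ w := by
      intro y hy
      induction hy using Submodule.span_induction with
      | mem y hy =>
        obtain ⟨k, hk, rfl⟩ := hy
        have h2 := hw' (e.symm ⟨k, hb01 hk⟩)
        obtain ⟨j, hj, rfl⟩ := hb0T hk
        have hj' : a j ⬝ᵥ w = b j := by simpa [htight] using hj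
        simp only [Equiv.apply_symm_apply, Sum.elim_inl, hv] at h2 ⊢
        rw [h2, hj']
      | zero => simp
      | add y z _ _ h1 h2 => rw [add_dotProduct, h1, h2, add_dotProduct]
      | smul r y _ h1 => rw [smul_dotProduct, h1, smul_dotProduct]
    have h2 : ∀ j ∈ tight w, a j ⬝ᵥ w' = b j := by
      intro j hj
      have h3 : v (Sum.inl j) ∈ Submodule.span ℝ (v '' b0) :=
        hb0s ⟨Sum.inl j, ⟨j, hj, rfl⟩, rfl⟩
      have h4 := h1 _ h3
      have hj' : a j ⬝ᵥ w = b j := by simpa [htight] using hj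
      simp only [hv, Sum.elim_inl] at h4
      rw [h4, hj']
    by_contra hcon
    push Not at hcon
    set V := Finset.univ.filter fun j => a j ⬝ᵥ w' < b j with hV
    have hVne : V.Nonempty := by
      obtain ⟨j, hj⟩ := hcon
      exact ⟨j, by simp [hV, hj]⟩
    obtain ⟨j0, hj0, hmin⟩ := V.exists_min_image
      (fun j => (a j ⬝ᵥ w - b j) / (a j ⬝ᵥ w - a j ⬝ᵥ w')) hVne
    set t := (a j0 ⬝ᵥ w - b j0) / (a j0 ⬝ᵥ w - a j0 ⬝ᵥ w') with ht
    have hVlt : ∀ j ∈ V, 0 < a j ⬝ᵥ w - a j ⬝ᵥ w' := by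
      intro j hj
      have h5 : a j ⬝ᵥ w' < b j := by simpa [hV] using hj
      linarith [hw j]
    have ht0 : 0 ≤ t := div_nonneg (by linarith [hw j0]) (hVlt j0 hj0).le
    have hj0' : a j0 ⬝ᵥ w' < b j0 := by simpa [hV] using hj0
    have ht1 : t ≤ 1 := by
      rw [ht, div_le_one (hVlt j0 hj0)]; linarith
    set w2 : Fin d → ℝ := w + t • (w' - w) with hw2
    have hdot : ∀ j, a j ⬝ᵥ w2 = a j ⬝ᵥ w + t * (a j ⬝ᵥ w' - a j ⬝ᵥ w) := by
      intro j
      rw [hw2, dotProduct_add, dotProduct_smul, dotProduct_sub, smul_eq_mul]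
    have hfeas : ∀ j, b j ≤ a j ⬝ᵥ w2 := by
      intro j
      rw [hdot]
      by_cases hj : j ∈ V
      · have h6 := hmin j hj
        rw [le_div_iff₀ (hVlt j hj)] at h6
        linarith
      · have h6 : b j ≤ a j ⬝ᵥ w' := by simpa [hV] using hj
        nlinarith [hw j]
    have htt : t * (a j0 ⬝ᵥ w - a j0 ⬝ᵥ w') = a j0 ⬝ᵥ w - b j0 := by
      rw [ht, div_mul_cancel₀ _ (hVlt j0 hj0).ne']
    have hlt : (tight w).card < (tight w2).card := by
      apply Finset.card_lt_card
      rw [Finset.ssubset_iff_of_subset]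
      · refine ⟨j0, ?_, ?_⟩
        · simp only [htight, Finset.mem_filter, Finset.mem_univ, true_and]
          rw [hdot]; linarith
        · intro hj
          have := h2 j0 hj
          linarith
      · intro j hj
        have h7 := h2 j hj
        simp only [htight, Finset.mem_filter, Finset.mem_univ, true_and] at hj ⊢
        rw [hdot, h7, hj]; ring
    exact absurd (hmax' w2 hfeas) (by omega)

/-- the coefficient matrix attached to a choice of rows -/
noncomputable def rowM {m d : ℕ} (c : Fin m → Fin d → ℝ → ℝ) (φ : Fin d → (Fin m ⊕ Fin d) × Bool)
    (p : ℝ) : Matrix (Fin d) (Fin d) ℝ :=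
  fun k => Sum.elim (fun j i => c j i p) (fun i => Pi.single i 1) (φ k).1

/-- right-hand side -/
noncomputable def rowR {m d : ℕ} (φ : Fin d → (Fin m ⊕ Fin d) × Bool) : Fin d → ℝ :=
  fun k => if (φ k).2 then -1 else 0

/-- the value of the `j`-th functional at the Cramer solution, times the squared determinant -/
noncomputable def rowF {m d : ℕ} (c : Fin m → Fin d → ℝ → ℝ) (φ : Fin d → (Fin m ⊕ Fin d) × Bool)
    (j : Fin m) (p : ℝ) : ℝ :=
  (rowM c φ p).det * ∑ i, c j i p * (rowM c φ p).cramer (rowR φ) i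

/-- number of exponential terms -/
def KK (d : ℕ) : ℕ := (d.factorial * 2 ^ d) * (d * (2 * (d.factorial * 2 ^ d)))

/-- bound on the growth function -/
def GG (m d : ℕ) : ℕ := (2 * (m + d)) ^ d * (2 * (m * KK d + 1))

lemma rowF_ES {m d : ℕ} (c : Fin m → Fin d → ℝ → ℝ) (hc : ∀ j i, ES 2 (c j i))
    (φ : Fin d → (Fin m ⊕ Fin d) × Bool) (j : Fin m) : ES (KK d) (rowF c φ j) := by
  have hM : ∀ k i, ES 2 (fun p => rowM c φ p k i) := by
    intro k i
    unfold rowM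
    rcases (φ k).1 with j | i'
    · exact hc j i
    · exact (ES.const _).mono (by norm_num)
  have hC : ∀ i, ES (d.factorial * 2 ^ d) (fun p => (rowM c φ p).cramer (rowR φ) i) := by
    intro i
    simp only [Matrix.cramer_apply]
    refine ES.det fun k i' => ?_
    simp only [Matrix.updateCol_apply]
    by_cases h : i' = i
    · simp only [h, if_true]
      exact (ES.const _).mono (by norm_num)
    · simp only [h, if_false]
      exact hM k i'
  have hS := ES.sum (fun i : Fin d => (hc j i).mul (hC i))
  rw [Fintype.card_fin] at hS
  exact (ES.det hM).mul hS

lemma growth {m d : ℕ} (c : Fin m → Fin d → ℝ → ℝ) (hc : ∀ j i, ES 2 (c j i)) :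
    ∃ P : Finset (Fin m → Prop), P.card ≤ GG m d ∧
      ∀ (w : Fin d → ℝ) (p : ℝ), (fun j => 0 ≤ ∑ i, w i * c j i p) ∈ P := by
  classical
  choose P hP1 hP2 using fun φ => one_param (rowF c φ) (rowF_ES c hc φ)
  refine ⟨Finset.univ.biUnion P, ?_, ?_⟩
  · refine Finset.card_biUnion_le.trans
      ((Finset.sum_le_card_nsmul _ _ _ fun φ _ => hP1 φ).trans ?_)
    simp [GG, mul_comm]
  intro w p
  set a : Fin m → Fin d → ℝ := fun j i => c j i p with ha
  have hsum : ∀ (x : Fin d → ℝ) j, ∑ i, x i * c j i p = a j ⬝ᵥ x := by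
    intro x j
    simp [dotProduct, ha, mul_comm]
  simp only [hsum]
  set A : Fin m → Fin d → ℝ := fun j => if 0 ≤ a j ⬝ᵥ w then a j else - a j with hA
  set b : Fin m → ℝ := fun j => if 0 ≤ a j ⬝ᵥ w then 0 else 1 with hb
  set s : ℝ := ∑ j, |a j ⬝ᵥ w|⁻¹ with hs
  have hs0 : 0 ≤ s := Finset.sum_nonneg fun j _ => by positivity
  have hs1 : ∀ j, |a j ⬝ᵥ w|⁻¹ ≤ s := fun j =>
    Finset.single_le_sum (f := fun j => |a j ⬝ᵥ w|⁻¹) (fun j _ => by positivity)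
      (Finset.mem_univ j)
  obtain ⟨φ, hφ1, hφ2⟩ := poly A b (s • w) (by
    intro j
    simp only [hA, hb]
    split_ifs with h
    · rw [dotProduct_smul, smul_eq_mul]; positivity
    · push Not at h
      rw [dotProduct_smul, smul_eq_mul, neg_dotProduct]
      have h1 := hs1 j
      rw [abs_of_neg h, inv_le_iff_one_le_mul₀ (by linarith)] at h1
      linarith)
  set ψ : Fin d → (Fin m ⊕ Fin d) × Bool := fun k =>
    (φ k, Sum.elim (fun j => decide (¬ 0 ≤ a j ⬝ᵥ w)) (fun _ => false) (φ k)) with hψ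
  refine Finset.mem_biUnion.2 ⟨ψ, Finset.mem_univ _, ?_⟩
  set M := rowM c ψ p with hM
  have hsol : ∀ (x : Fin d → ℝ) (r : ℝ), M.mulVec x = r • rowR ψ →
      ∀ k, Sum.elim A (fun i => Pi.single i 1) (φ k) ⬝ᵥ x = r * Sum.elim b (fun _ => 0) (φ k) := by
    intro x r hx k
    have h1 := congrFun hx k
    simp only [Matrix.mulVec, Pi.smul_apply, smul_eq_mul, hM, rowM, rowR, hψ] at h1
    rcases hk : φ k with j | i
    · simp only [hk, Sum.elim_inl] at h1 ⊢
      simp only [hA, hb]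
      by_cases h : 0 ≤ a j ⬝ᵥ w
      · simp only [h, if_true, not_true, decide_false, mul_zero] at h1 ⊢
        simpa using h1
      · simp only [h, if_false, not_false_iff, decide_true, if_true] at h1 ⊢
        rw [neg_dotProduct, mul_one]
        change a j ⬝ᵥ x = _ at h1
        rw [h1]; ring
    · simp only [hk, Sum.elim_inr] at h1 ⊢
      simpa using h1
  have hdet : M.det ≠ 0 := by
    intro h
    obtain ⟨x, hx0, hx⟩ := Matrix.exists_mulVec_eq_zero_iff.2 h
    apply hx0
    apply hφ1
    intro k
    have := hsol x 0 (by rw [hx, zero_smul]) k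
    rw [this, zero_mul]
  set w' : Fin d → ℝ := M.det⁻¹ • M.cramer (rowR ψ) with hw'
  have hw'sol : M.mulVec w' = (1 : ℝ) • rowR ψ := by
    rw [hw', Matrix.mulVec_smul, Matrix.mulVec_cramer, smul_smul, inv_mul_cancel₀ hdet]
  have hfeas := hφ2 w' (fun k => by rw [hsol w' 1 hw'sol k, one_mul])
  have hF : ∀ j, rowF c ψ j p = M.det ^ 2 * (a j ⬝ᵥ w') := by
    intro j
    rw [rowF, ← hM, hw', dotProduct_smul, smul_eq_mul]
    have : ∑ i, c j i p * (M.cramer (rowR ψ)) i = a j ⬝ᵥ M.cramer (rowR ψ) := rfl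
    rw [this]
    field_simp
  have heq : (fun j => 0 ≤ a j ⬝ᵥ w) = fun j => 0 ≤ rowF c ψ j p := by
    funext j
    apply propext
    rw [hF, mul_nonneg_iff_of_pos_left (by positivity)]
    have h1 := hfeas j
    simp only [hA, hb] at h1
    by_cases h : 0 ≤ a j ⬝ᵥ w
    · simp only [h, if_true] at h1
      simp [h, h1]
    · simp only [h, if_false, neg_dotProduct] at h1
      simp only [h, false_iff]
      linarith
  rw [heq]
  exact hP2 ψ p


lemma proj_meas {X Q : Type*} [MetricSpace X] [MeasurableSpace X] [BorelSpace X]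
    [MetricSpace Q] [SigmaCompactSpace Q] (F U : Set (X × Q)) (hF : IsClosed F) (hU : IsOpen U) :
    MeasurableSet {x | ∃ q, (x, q) ∈ F ∧ (x, q) ∈ U} := by
  obtain ⟨G, hG, -, hGU, -⟩ := hU.exists_iUnion_isClosed
  have : {x | ∃ q, (x, q) ∈ F ∧ (x, q) ∈ U} = ⋃ k : ℕ, ⋃ l : ℕ,
      {x | ∃ q ∈ compactCovering Q l, (x, q) ∈ F ∧ (x, q) ∈ G k} := by
    ext x
    simp only [Set.mem_ofPred_eq, Set.mem_iUnion, ← hGU]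
    constructor
    · rintro ⟨q, h1, k, h2⟩
      obtain ⟨l, hl⟩ := exists_mem_compactCovering q
      exact ⟨k, l, q, hl, h1, h2⟩
    · rintro ⟨k, l, q, hl, h1, h2⟩
      exact ⟨q, h1, k, h2⟩
  rw [this]
  refine MeasurableSet.iUnion fun k => MeasurableSet.iUnion fun l => IsClosed.measurableSet ?_
  have : CompactSpace (compactCovering Q l) :=
    isCompact_iff_compactSpace.1 (isCompact_compactCovering Q l)
  have hcl : IsClosed ((fun z : X × compactCovering Q l => (z.1, (z.2 : Q))) ⁻¹' (F ∩ G k)) :=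
    (hF.inter (hG k)).preimage (by fun_prop)
  have := isClosedMap_fst_of_compactSpace _ hcl
  convert this using 1
  ext x
  constructor
  · rintro ⟨q, h1, h2, h3⟩
    exact ⟨(x, ⟨q, h1⟩), ⟨h2, h3⟩, rfl⟩
  · rintro ⟨⟨x', q⟩, ⟨h2, h3⟩, rfl⟩
    exact ⟨q.1, q.2, h2, h3⟩

/-- sample space -/
abbrev Om (d : ℕ) := ((Fin d → ℝ) × (Fin d → ℝ)) × ℝ

/-- linear score in logarithmic coordinates -/
noncomputable def HH {d : ℕ} (g : ℝ → ℝ → ℝ → ℝ) (y : (Fin d → ℝ) × (Fin d → ℝ))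
    (q : (Fin d → ℝ) × ℝ) : ℝ := ∑ i, q.1 i * g (y.1 i) (y.2 i) q.2

/-- logarithmic coordinates -/
noncomputable def lg {d : ℕ} (z : Om d) : (Fin d → ℝ) × (Fin d → ℝ) :=
  (fun i => Real.log (z.1.1 i), fun i => Real.log (z.1.2 i))

open Classical in
/-- loss of a prediction -/
noncomputable def ls (b : Prop) (y : ℝ) : ℝ :=
  if b then (if y = 1 then 1 else 0) else (if y = -1 then 1 else 0)

/-- the loss family -/
noncomputable def LL {d : ℕ} (g : ℝ → ℝ → ℝ → ℝ) (q : (Fin d → ℝ) × ℝ) (z : Om d) : ℝ :=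
  ls (0 ≤ HH g (lg z) q) z.2

lemma ls_nonneg (b : Prop) (y : ℝ) : 0 ≤ ls b y := by
  unfold ls; split_ifs <;> norm_num

lemma ls_le_one (b : Prop) (y : ℝ) : ls b y ≤ 1 := by
  unfold ls; split_ifs <;> norm_num

lemma ls_meas (b : Prop) : Measurable (ls b) := by
  unfold ls
  by_cases h : b
  · simp only [h, if_true]
    exact Measurable.ite (measurableSet_singleton _) measurable_const measurable_const
  · simp only [h, if_false]
    exact Measurable.ite (measurableSet_singleton _) measurable_const measurable_const

lemma lg_meas {d : ℕ} : Measurable (lg (d := d)) := by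
  unfold lg
  refine Measurable.prodMk ?_ ?_
  · exact measurable_pi_lambda _ fun i => Real.measurable_log.comp
      ((measurable_pi_apply i).comp (measurable_fst.comp measurable_fst))
  · exact measurable_pi_lambda _ fun i => Real.measurable_log.comp
      ((measurable_pi_apply i).comp (measurable_snd.comp measurable_fst))

lemma HH_cont {d : ℕ} (g : ℝ → ℝ → ℝ → ℝ)
    (hg : Continuous fun t : ℝ × ℝ × ℝ => g t.1 t.2.1 t.2.2) :
    Continuous fun t : ((Fin d → ℝ) × (Fin d → ℝ)) × ((Fin d → ℝ) × ℝ) => HH g t.1 t.2 := by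
  unfold HH
  refine continuous_finsetSum _ fun i _ => Continuous.mul (by fun_prop) ?_
  exact hg.comp (f := fun t : ((Fin d → ℝ) × (Fin d → ℝ)) × ((Fin d → ℝ) × ℝ) =>
    (t.1.1 i, t.1.2 i, t.2.2)) (by fun_prop)

lemma LL_meas {d : ℕ} (g : ℝ → ℝ → ℝ → ℝ)
    (hg : Continuous fun t : ℝ × ℝ × ℝ => g t.1 t.2.1 t.2.2) (q : (Fin d → ℝ) × ℝ) :
    Measurable (LL (d := d) g q) := by
  have h1 : Measurable fun z : Om d => HH g (lg z) q := by
    have : Continuous fun y : (Fin d → ℝ) × (Fin d → ℝ) => HH g y q :=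
      (HH_cont g hg).comp (by fun_prop : Continuous fun y : (Fin d → ℝ) × (Fin d → ℝ) => (y, q))
    exact this.measurable.comp lg_meas
  have h2 : LL (d := d) g q = fun z => @ite _ (0 ≤ HH g (lg z) q) (Classical.propDecidable _)
      (ls True z.2) (ls False z.2) := by
    funext z
    unfold LL
    split_ifs with h <;> simp [h]
  rw [h2]
  exact Measurable.ite (measurableSet_le measurable_const h1)
    ((ls_meas _).comp measurable_snd) ((ls_meas _).comp measurable_snd)

/-- the doubled sample -/
def zp {d n : ℕ} (x : Fin n → Om d × Om d) (k : Fin n × Bool) : Om d :=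
  if k.2 then (x k.1).1 else (x k.1).2

lemma zp_meas {d n : ℕ} (k : Fin n × Bool) : Measurable fun x : Fin n → Om d × Om d => zp x k := by
  unfold zp
  split_ifs
  · exact measurable_fst.comp (measurable_pi_apply _)
  · exact measurable_snd.comp (measurable_pi_apply _)

lemma pattern_meas {d n : ℕ} (g : ℝ → ℝ → ℝ → ℝ)
    (hg : Continuous fun t : ℝ × ℝ × ℝ => g t.1 t.2.1 t.2.2) (τ : Fin n × Bool → Prop) :
    MeasurableSet {x : Fin n → Om d × Om d |
      ∃ q : (Fin d → ℝ) × ℝ, ∀ k, (0 ≤ HH g (lg (zp x k)) q ↔ τ k)} := by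
  set Y := Fin n × Bool → (Fin d → ℝ) × (Fin d → ℝ)
  have hcont : ∀ k, Continuous fun t : Y × ((Fin d → ℝ) × ℝ) => HH g (t.1 k) t.2 := fun k =>
    (HH_cont g hg).comp (f := fun t : Y × ((Fin d → ℝ) × ℝ) => (t.1 k, t.2)) (by fun_prop)
  have h1 := proj_meas (X := Y) (Q := (Fin d → ℝ) × ℝ)
    (⋂ k, {t | τ k → 0 ≤ HH g (t.1 k) t.2}) (⋂ k, {t | ¬ τ k → HH g (t.1 k) t.2 < 0})
    (by
      refine isClosed_iInter fun k => ?_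
      by_cases h : τ k
      · simp only [h, true_imp_iff]
        exact isClosed_le continuous_const (hcont k)
      · simp [h])
    (by
      refine isOpen_iInter_of_finite fun k => ?_
      by_cases h : τ k
      · simp [h]
      · simp only [h, not_false_iff, true_imp_iff]
        exact isOpen_lt (hcont k) continuous_const)
  have h2 : Measurable fun (x : Fin n → Om d × Om d) => (fun k => lg (zp x k) : Y) :=
    measurable_pi_lambda _ fun k => lg_meas.comp (zp_meas k)
  convert h2 h1 using 1
  ext x
  simp only [Set.mem_ofPred_eq, Set.mem_preimage, Set.mem_iInter, ← forall_and]
  refine exists_congr fun q => forall_congr' fun k => ?_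
  by_cases h : τ k <;> simp [h]

lemma A_meas {d n : ℕ} (g : ℝ → ℝ → ℝ → ℝ)
    (hg : Continuous fun t : ℝ × ℝ × ℝ => g t.1 t.2.1 t.2.2) (T : ℝ) :
    MeasurableSet {x : Fin n → Om d × Om d |
      ∃ q : (Fin d → ℝ) × ℝ, T / 2 < |∑ i, (LL g q (x i).1 - LL g q (x i).2)|} := by
  have : {x : Fin n → Om d × Om d |
      ∃ q : (Fin d → ℝ) × ℝ, T / 2 < |∑ i, (LL g q (x i).1 - LL g q (x i).2)|} =
      ⋃ τ : Fin n × Bool → Prop, {x : Fin n → Om d × Om d |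
      ∃ q : (Fin d → ℝ) × ℝ, ∀ k, (0 ≤ HH g (lg (zp x k)) q ↔ τ k)} ∩
      {x | T / 2 < |∑ i, (ls (τ (i, true)) (x i).1.2 - ls (τ (i, false)) (x i).2.2)|} := by
    ext x
    simp only [Set.mem_ofPred_eq, Set.mem_iUnion, Set.mem_inter_iff]
    constructor
    · rintro ⟨q, hq⟩
      refine ⟨fun k => 0 ≤ HH g (lg (zp x k)) q, ⟨q, fun k => Iff.rfl⟩, ?_⟩
      simpa [zp, LL] using hq
    · rintro ⟨τ, ⟨q, hq⟩, h⟩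
      refine ⟨q, ?_⟩
      have h3 : ∀ k, τ k = (0 ≤ HH g (lg (zp x k)) q) := fun k => (propext (hq k)).symm
      simpa [zp, LL, h3] using h
  rw [this]
  refine MeasurableSet.iUnion fun τ => (pattern_meas g hg τ).inter ?_
  refine measurableSet_lt measurable_const (Measurable.abs ?_)
  refine Finset.measurable_fun_sum _ fun i _ => Measurable.sub ?_ ?_
  · exact (ls_meas _).comp (measurable_snd.comp (measurable_fst.comp (measurable_pi_apply i)))
  · exact (ls_meas _).comp (measurable_snd.comp (measurable_snd.comp (measurable_pi_apply i)))

lemma family_bound {d n : ℕ} (hn : 1 ≤ n) (D : Measure (Om d)) [IsProbabilityMeasure D]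
    (g : ℝ → ℝ → ℝ → ℝ)
    (hg : Continuous fun t : ℝ × ℝ × ℝ => g t.1 t.2.1 t.2.2) (hES : ∀ a b, ES 2 (g a b))
    (T : ℝ) (hT : 0 < T) (hnT : 2 * n ≤ T ^ 2) :
    (Measure.pi fun _ : Fin n => D)
      {s | ∃ q : (Fin d → ℝ) × ℝ, T < |∑ i, LL g q (s i) - n * ∫ z, LL g q z ∂D|}
      ≤ ENNReal.ofReal (4 * (GG (2 * n) d : ℕ) * Real.exp (-(T ^ 2 / (8 * n)))) := by
  classical
  refine symm_bound D hn (LL g) (fun _ _ => ls_nonneg _ _) (fun _ _ => ls_le_one _ _)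
    (LL_meas g hg) T hT hnT _ (A_meas g hg T) ?_
  intro x
  let e : Fin n × Bool ≃ Fin (2 * n) := Fintype.equivFinOfCardEq (by simp [mul_comm])
  obtain ⟨P, hP1, hP2⟩ := growth
    (fun (j : Fin (2 * n)) (i : Fin d) => g ((lg (zp x (e.symm j))).1 i) ((lg (zp x (e.symm j))).2 i))
    (fun j i => hES _ _)
  refine ⟨P.image fun τ i => ls (τ (e (i, true))) (x i).1.2 - ls (τ (e (i, false))) (x i).2.2,
    Finset.card_image_le.trans hP1, ?_⟩
  intro q
  refine Finset.mem_image.2 ⟨_, hP2 q.1 q.2, ?_⟩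
  funext i
  simp [LL, HH, zp]

/-- first family: exponential -/
noncomputable def g1 (a b p : ℝ) : ℝ := Real.exp (a * p) - Real.exp (b * p)

/-- second family: geometric mean -/
noncomputable def g2 (a b _p : ℝ) : ℝ := a - b

lemma g1_ES (a b : ℝ) : ES 2 (g1 a b) := by
  have := (ES.exp a).add ((ES.exp b).cmul (-1))
  convert this using 2 with p
  simp [g1]; ring

lemma g2_ES (a b : ℝ) : ES 2 (g2 a b) := (ES.const (a - b)).mono (by norm_num)

lemma g1_cont : Continuous fun t : ℝ × ℝ × ℝ => g1 t.1 t.2.1 t.2.2 := by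
  unfold g1; fun_prop

lemma g2_cont : Continuous fun t : ℝ × ℝ × ℝ => g2 t.1 t.2.1 t.2.2 := by
  unfold g2; fun_prop

lemma sgn_loss (t y : ℝ) (hy : y = 1 ∨ y = -1) : (1 + y * sgn t) / 2 = ls (0 ≤ t) y := by
  unfold sgn ls
  rcases hy with rfl | rfl <;> split_ifs <;> norm_num at *

lemma wsum_pos {d : ℕ} (w u : Fin d → ℝ) (hw : inSimplex w) (hu : ∀ i, 0 < u i) :
    0 < ∑ i, w i * u i := by
  have h0 : ∀ i ∈ Finset.univ, 0 ≤ w i * u i := fun i _ => mul_nonneg (hw.1 i) (hu i).le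
  refine lt_of_le_of_ne (Finset.sum_nonneg h0) fun h => ?_
  have h1 := (Finset.sum_eq_zero_iff_of_nonneg h0).1 h.symm
  have h2 : ∀ i, w i = 0 := fun i => by
    rcases mul_eq_zero.1 (h1 i (Finset.mem_univ i)) with h | h
    · exact h
    · exact absurd h (hu i).ne'
  have := hw.2
  simp [h2] at this

/-- every comparison function belongs to one of the two families on positive inputs -/
lemma reduce {d : ℕ} (w : Fin d → ℝ) (hw : inSimplex w) (p : ℝ) :
    (∃ q : (Fin d → ℝ) × ℝ, ∀ z : Om d, (∀ i, 0 < z.1.1 i) → (∀ i, 0 < z.1.2 i) →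
      (z.2 = 1 ∨ z.2 = -1) → (1 + z.2 * pcmp z.1.1 z.1.2 w p) / 2 = LL g1 q z) ∨
    (∃ q : (Fin d → ℝ) × ℝ, ∀ z : Om d, (∀ i, 0 < z.1.1 i) → (∀ i, 0 < z.1.2 i) →
      (z.2 = 1 ∨ z.2 = -1) → (1 + z.2 * pcmp z.1.1 z.1.2 w p) / 2 = LL g2 q z) := by
  by_cases hp : p = 0
  · right
    refine ⟨(w, 0), fun z hu hv hy => ?_⟩
    have hl : ∀ u : Fin d → ℝ, (∀ i, 0 < u i) →
        Real.log (pmean u w p) = ∑ i, w i * Real.log (u i) := by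
      intro u hu
      rw [pmean, if_pos hp, Real.log_prod (fun i _ => (Real.rpow_pos_of_pos (hu i) _).ne')]
      exact Finset.sum_congr rfl fun i _ => Real.log_rpow (hu i) _
    rw [pcmp, sgn_loss _ _ hy, hl _ hu, hl _ hv, LL, HH, ← Finset.sum_sub_distrib]
    simp only [lg, g2, mul_sub]
  · left
    have hl : ∀ u : Fin d → ℝ, Real.log (pmean u w p)
        = (1 / p) * Real.log (∑ i, w i * u i ^ p) ∨ ¬ (∀ i, 0 < u i) := by
      intro u
      by_cases hu : ∀ i, 0 < u i
      · left
        rw [pmean, if_neg hp, Real.log_rpow]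
        exact wsum_pos w _ hw fun i => Real.rpow_pos_of_pos (hu i) _
      · exact Or.inr hu
    refine ⟨((fun i => if 0 < p then w i else - w i), p), fun z hu hv hy => ?_⟩
    have h1 := (hl z.1.1).resolve_right (not_not.2 hu)
    have h2 := (hl z.1.2).resolve_right (not_not.2 hv)
    have hSu : 0 < ∑ i, w i * z.1.1 i ^ p :=
      wsum_pos w _ hw fun i => Real.rpow_pos_of_pos (hu i) _
    have hSv : 0 < ∑ i, w i * z.1.2 i ^ p :=
      wsum_pos w _ hw fun i => Real.rpow_pos_of_pos (hv i) _
    rw [pcmp, sgn_loss _ _ hy, h1, h2, LL]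
    congr 1
    apply propext
    have hH : HH g1 (lg z) ((fun i => if 0 < p then w i else - w i), p) =
        (if 0 < p then 1 else -1) * (∑ i, w i * z.1.1 i ^ p - ∑ i, w i * z.1.2 i ^ p) := by
      rw [HH, ← Finset.sum_sub_distrib, Finset.mul_sum]
      refine Finset.sum_congr rfl fun i _ => ?_
      simp only [lg, g1]
      rw [Real.rpow_def_of_pos (hu i), Real.rpow_def_of_pos (hv i)]
      split_ifs <;> ring
    rw [hH, ← mul_sub]
    have hlog := Real.log_le_log_iff hSv hSu
    have hlog' := Real.log_le_log_iff hSu hSv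
    by_cases h : 0 < p
    · rw [if_pos h, one_mul, mul_nonneg_iff_of_pos_left (by positivity), sub_nonneg, sub_nonneg, hlog]
    · have hneg : p < 0 := lt_of_le_of_ne (not_lt.1 h) hp
      have hinv : 1 / p < 0 := one_div_neg.2 hneg
      rw [if_neg h, neg_one_mul, neg_nonneg, sub_nonpos, ← hlog']
      constructor
      · intro h5
        by_contra h6
        push Not at h6
        nlinarith [mul_neg_of_neg_of_pos hinv (sub_pos.2 h6)]
      · intro h5
        exact mul_nonneg_of_nonpos_of_nonpos hinv.le (sub_nonpos.2 h5)

lemma GG_bound {d n : ℕ} (hd : 2 ≤ d) (hn : 1 ≤ n) :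
    ((GG (2 * n) d : ℕ) : ℝ) ≤
      Real.exp (64 * ((d : ℝ) * Real.logb 2 d + 1) * Real.log (n + 1)) := by
  have hd2 : (2 : ℝ) ≤ d := by exact_mod_cast hd
  have hn1 : (1 : ℝ) ≤ n := by exact_mod_cast hn
  set l := Real.logb 2 d with hl
  have hl1 : 1 ≤ l := by
    rw [hl, Real.le_logb_iff_rpow_le (by norm_num) (by linarith)]; simpa using hd2
  have hlog2 : Real.log 2 ≤ Real.log (n + 1) := Real.log_le_log (by norm_num) (by linarith)
  have hlogn : 0 < Real.log (n + 1) := Real.log_pos (by linarith)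
  set E := Real.exp (l * Real.log (n + 1)) with hE
  have hEn : (n : ℝ) + 1 ≤ E := by
    calc (n : ℝ) + 1 = Real.exp (Real.log (n + 1)) := (Real.exp_log (by linarith)).symm
      _ ≤ E := Real.exp_le_exp.2 (by nlinarith)
  have hEd : (d : ℝ) ≤ E := by
    have h1 : l * Real.log 2 = Real.log d := by
      rw [hl, Real.logb, div_mul_cancel₀]
      exact (Real.log_pos (by norm_num)).ne'
    calc (d : ℝ) = Real.exp (Real.log d) := (Real.exp_log (by linarith)).symm
      _ ≤ E := Real.exp_le_exp.2 (by rw [← h1]; gcongr)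
  have hE2 : 2 ≤ E := hd2.trans hEd
  have hE1 : 1 ≤ E := by linarith
  have hE0 : 0 ≤ E := by linarith
  have h1 : 2 * (2 * (n : ℝ) + d) ≤ E ^ 4 := by
    have : E ^ 4 = E ^ 2 * E ^ 2 := by ring
    have h4 : 4 ≤ E ^ 2 := by nlinarith
    have : 4 * E ^ 2 ≤ E ^ 4 := by nlinarith
    nlinarith
  have h2 : (d.factorial : ℝ) * 2 ^ d ≤ E ^ (2 * d) := by
    have h3 : (d.factorial : ℝ) ≤ E ^ d := by
      have : (d.factorial : ℝ) ≤ (d : ℝ) ^ d := by exact_mod_cast Nat.factorial_le_pow d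
      exact this.trans (by gcongr)
    calc (d.factorial : ℝ) * 2 ^ d ≤ E ^ d * E ^ d := by gcongr
      _ = E ^ (2 * d) := by ring
  have h3 : ((KK d : ℕ) : ℝ) ≤ E ^ (4 * d + 2) := by
    unfold KK
    push_cast
    calc (d.factorial : ℝ) * 2 ^ d * (d * (2 * (d.factorial * 2 ^ d)))
        ≤ E ^ (2 * d) * (E * (E * E ^ (2 * d))) := by gcongr
      _ = E ^ (4 * d + 2) := by ring
  have h4 : 2 * (2 * (n : ℝ) * (KK d : ℕ) + 1) ≤ E ^ (4 * d + 6) := by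
    have h5 : 2 * (n : ℝ) ≤ E * E := by nlinarith
    have h6 : 2 * (n : ℝ) * (KK d : ℕ) ≤ E * E * E ^ (4 * d + 2) := by gcongr
    have h7 : (1 : ℝ) ≤ E ^ (4 * d + 4) := one_le_pow₀ hE1
    calc 2 * (2 * (n : ℝ) * (KK d : ℕ) + 1) ≤ 2 * (E ^ (4 * d + 4) + E ^ (4 * d + 4)) := by
          have : E * E * E ^ (4 * d + 2) = E ^ (4 * d + 4) := by ring
          linarith
      _ = 2 * 2 * E ^ (4 * d + 4) := by ring
      _ ≤ E * E * E ^ (4 * d + 4) := by gcongr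
      _ = _ := by ring
  have h5 : ((GG (2 * n) d : ℕ) : ℝ) ≤ E ^ (64 * d) := by
    unfold GG
    push_cast
    calc (2 * (2 * (n : ℝ) + d)) ^ d * (2 * (2 * (n : ℝ) * (KK d : ℕ) + 1))
        ≤ (E ^ 4) ^ d * E ^ (4 * d + 6) := by gcongr
      _ = E ^ (8 * d + 6) := by rw [← pow_mul, ← pow_add]; congr 1; ring
      _ ≤ E ^ (64 * d) := pow_le_pow_right₀ hE1 (by omega)
  refine h5.trans ?_
  rw [hE, ← Real.exp_nat_mul]
  apply Real.exp_le_exp.2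
  push_cast
  nlinarith

end PacAux

/-- PAC bound for learning a power mean with unknown weights from noiseless
pairwise comparisons under the 0-1 loss. -/
theorem comparison_pac_unknown_weights (d : ℕ) (hd : 2 ≤ d)
    (umin umax : ℝ) (hmin : 0 < umin) (hle : umin ≤ umax)
    (D : Measure (((Fin d → ℝ) × (Fin d → ℝ)) × ℝ)) [IsProbabilityMeasure D]
    (hsupp : D {z | (∀ i, z.1.1 i ∈ Set.Icc umin umax) ∧
        (∀ i, z.1.2 i ∈ Set.Icc umin umax) ∧ (z.2 = 1 ∨ z.2 = -1)} = 1)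
    (n : ℕ) (hn : 1 ≤ n) (δ : ℝ) (hδ : 0 < δ)
    (erm : (Fin n → ((Fin d → ℝ) × (Fin d → ℝ)) × ℝ) → (Fin d → ℝ) × ℝ)
    (herm : ∀ s : Fin n → ((Fin d → ℝ) × (Fin d → ℝ)) × ℝ, inSimplex (erm s).1 ∧
      (1 / n : ℝ) * ∑ i, (1 + (s i).2 * pcmp (s i).1.1 (s i).1.2 (erm s).1 (erm s).2) / 2
        = ⨅ q : {w : Fin d → ℝ // inSimplex w} × ℝ,
            (1 / n : ℝ) * ∑ i, (1 + (s i).2 * pcmp (s i).1.1 (s i).1.2 q.1.1 q.2) / 2) :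
    (Measure.pi fun _ : Fin n => D)
        {s | (∫ z, (1 + z.2 * pcmp z.1.1 z.1.2 (erm s).1 (erm s).2) / 2 ∂D)
              - (⨅ q : {w : Fin d → ℝ // inSimplex w} × ℝ,
                    ∫ z, (1 + z.2 * pcmp z.1.1 z.1.2 q.1.1 q.2) / 2 ∂D)
            ≤ 16 * Real.sqrt ((8 * ((d : ℝ) * Real.logb 2 d + 1) * Real.log (n + 1)
                + Real.log (8 / δ)) / n)}
      ≥ ENNReal.ofReal (1 - δ) := by
  classical
  by_cases hδ1 : 1 ≤ δ
  · rw [ENNReal.ofReal_of_nonpos (by linarith)]; exact zero_le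
  push Not at hδ1
  have hn0 : (0 : ℝ) < n := by exact_mod_cast hn
  have hd2 : (2 : ℝ) ≤ d := by exact_mod_cast hd
  set X : ℝ := 8 * ((d : ℝ) * Real.logb 2 d + 1) * Real.log (n + 1) + Real.log (8 / δ) with hX
  have hlogb : 0 ≤ Real.logb 2 d := Real.logb_nonneg (by norm_num) (by linarith)
  have hlogn : 0 ≤ Real.log (n + 1) := Real.log_nonneg (by linarith)
  have hlog8 : 2 ≤ Real.log (8 / δ) := by
    have h1 : Real.log 8 ≤ Real.log (8 / δ) := by
      apply Real.log_le_log (by norm_num)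
      rw [le_div_iff₀ hδ]; linarith
    have h2 : Real.log 8 = 3 * Real.log 2 := by
      rw [show (8 : ℝ) = 2 ^ 3 by norm_num, Real.log_pow]; norm_num
    have := Real.log_two_gt_d9
    linarith
  have hX2 : 2 ≤ X := by
    have : 0 ≤ 8 * ((d : ℝ) * Real.logb 2 d + 1) * Real.log (n + 1) := by positivity
    linarith
  set T : ℝ := 8 * Real.sqrt (n * X) with hT
  have hT2 : T ^ 2 = 64 * (n * X) := by
    rw [hT, mul_pow, Real.sq_sqrt (by positivity)]; norm_num
  have hT0 : 0 < T := by
    have : 0 < n * X := by positivity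
    have := Real.sqrt_pos.2 this
    positivity
  have hTn : 16 * Real.sqrt (X / n) = 2 * T / n := by
    have : X / n = (n * X) / n ^ 2 := by field_simp
    rw [this, Real.sqrt_div (by positivity), Real.sqrt_sq hn0.le, hT]
    ring
  have hnT : 2 * n ≤ T ^ 2 := by rw [hT2]; nlinarith
  have hexp : T ^ 2 / (8 * n) = 8 * X := by
    rw [hT2]; field_simp; ring
  -- probability bound
  have hprob : 4 * ((PacAux.GG (2 * n) d : ℕ) : ℝ) * Real.exp (-(T ^ 2 / (8 * n))) ≤ δ / 2 := by
    rw [hexp]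
    have h1 := PacAux.GG_bound hd hn
    have h2 : Real.exp (-(8 * X)) =
        Real.exp (-(64 * ((d : ℝ) * Real.logb 2 d + 1) * Real.log (n + 1))) *
        Real.exp (-(8 * Real.log (8 / δ))) := by
      rw [← Real.exp_add, hX]; congr 1; ring
    have h3 : Real.exp (-(8 * Real.log (8 / δ))) ≤ δ / 8 := by
      calc Real.exp (-(8 * Real.log (8 / δ))) ≤ Real.exp (-(Real.log (8 / δ))) :=
            Real.exp_le_exp.2 (by linarith)
        _ = δ / 8 := by rw [Real.exp_neg, Real.exp_log (by positivity), inv_div]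
    have h4 : ((PacAux.GG (2 * n) d : ℕ) : ℝ) *
        Real.exp (-(64 * ((d : ℝ) * Real.logb 2 d + 1) * Real.log (n + 1))) ≤ 1 := by
      rw [Real.exp_neg, ← div_eq_mul_inv, div_le_one (Real.exp_pos _)]
      exact h1
    rw [h2]
    calc 4 * ((PacAux.GG (2 * n) d : ℕ) : ℝ) *
          (Real.exp (-(64 * ((d : ℝ) * Real.logb 2 d + 1) * Real.log (n + 1))) *
          Real.exp (-(8 * Real.log (8 / δ))))
        = 4 * (((PacAux.GG (2 * n) d : ℕ) : ℝ) *
          Real.exp (-(64 * ((d : ℝ) * Real.logb 2 d + 1) * Real.log (n + 1)))) *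
          Real.exp (-(8 * Real.log (8 / δ))) := by ring
      _ ≤ 4 * 1 * (δ / 8) := by gcongr
      _ = δ / 2 := by ring
  set μ := (Measure.pi fun _ : Fin n => D) with hμ
  have hB1 := (PacAux.family_bound hn D PacAux.g1 PacAux.g1_cont PacAux.g1_ES T hT0 hnT).trans
    (ENNReal.ofReal_le_ofReal hprob)
  have hB2 := (PacAux.family_bound hn D PacAux.g2 PacAux.g2_cont PacAux.g2_ES T hT0 hnT).trans
    (ENNReal.ofReal_le_ofReal hprob)
  rw [← hμ] at hB1 hB2
  set B1 := {s : Fin n → PacAux.Om d | ∃ q : (Fin d → ℝ) × ℝ,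
    T < |∑ i, PacAux.LL PacAux.g1 q (s i) - n * ∫ z, PacAux.LL PacAux.g1 q z ∂D|} with hB1d
  set B2 := {s : Fin n → PacAux.Om d | ∃ q : (Fin d → ℝ) × ℝ,
    T < |∑ i, PacAux.LL PacAux.g2 q (s i) - n * ∫ z, PacAux.LL PacAux.g2 q z ∂D|} with hB2d
  -- support
  set S : Set (PacAux.Om d) := {z | (∀ i, z.1.1 i ∈ Set.Icc umin umax) ∧
        (∀ i, z.1.2 i ∈ Set.Icc umin umax) ∧ (z.2 = 1 ∨ z.2 = -1)} with hS
  have hSm : MeasurableSet S := by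
    have e1 : ∀ i, Measurable fun z : PacAux.Om d => z.1.1 i := fun i =>
      (measurable_pi_apply i).comp (measurable_fst.comp measurable_fst)
    have e2 : ∀ i, Measurable fun z : PacAux.Om d => z.1.2 i := fun i =>
      (measurable_pi_apply i).comp (measurable_snd.comp measurable_fst)
    have e3 : Measurable fun z : PacAux.Om d => z.2 := measurable_snd
    refine MeasurableSet.inter (s₁ := {z : PacAux.Om d | ∀ i, z.1.1 i ∈ Set.Icc umin umax}) ?_
      (MeasurableSet.inter (s₁ := {z : PacAux.Om d | ∀ i, z.1.2 i ∈ Set.Icc umin umax}) ?_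
      (MeasurableSet.union (s₁ := {z : PacAux.Om d | z.2 = 1}) (s₂ := {z : PacAux.Om d | z.2 = -1}) ?_ ?_))
    · have : {z : PacAux.Om d | ∀ i, z.1.1 i ∈ Set.Icc umin umax}
          = ⋂ i, (fun z : PacAux.Om d => z.1.1 i) ⁻¹' Set.Icc umin umax := by ext; simp
      rw [this]
      exact MeasurableSet.iInter fun i => e1 i measurableSet_Icc
    · have : {z : PacAux.Om d | ∀ i, z.1.2 i ∈ Set.Icc umin umax}
          = ⋂ i, (fun z : PacAux.Om d => z.1.2 i) ⁻¹' Set.Icc umin umax := by ext; simp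
      rw [this]
      exact MeasurableSet.iInter fun i => e2 i measurableSet_Icc
    · exact e3 (measurableSet_singleton _)
    · exact e3 (measurableSet_singleton _)
  have hSae : ∀ᵐ z ∂D, z ∈ S := (mem_ae_iff_prob_eq_one hSm).2 hsupp
  have hGae : ∀ᵐ s ∂μ, ∀ i, s i ∈ S := by
    rw [ae_all_iff]
    intro i
    exact (measurePreserving_eval (fun _ : Fin n => D) i).quasiMeasurePreserving.ae hSae
  set N := {s : Fin n → PacAux.Om d | ¬ ∀ i, s i ∈ S} with hN
  have hN0 : μ N = 0 := hGae
  -- uniform deviation off the bad sets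
  have hdev : ∀ s, s ∉ N → s ∉ B1 → s ∉ B2 → ∀ (w : Fin d → ℝ) (p : ℝ), inSimplex w →
      0 ≤ (1 / n : ℝ) * ∑ i, (1 + (s i).2 * pcmp (s i).1.1 (s i).1.2 w p) / 2 ∧
      |(1 / n : ℝ) * ∑ i, (1 + (s i).2 * pcmp (s i).1.1 (s i).1.2 w p) / 2
        - ∫ z, (1 + z.2 * pcmp z.1.1 z.1.2 w p) / 2 ∂D| ≤ T / n := by
    intro s hsN hs1 hs2 w p hw
    have hsS : ∀ i, s i ∈ S := by simpa [hN] using hsN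
    have hgen : ∀ (g : ℝ → ℝ → ℝ → ℝ) (q : (Fin d → ℝ) × ℝ),
        |∑ i, PacAux.LL g q (s i) - n * ∫ z, PacAux.LL g q z ∂D| ≤ T →
        (∀ z : PacAux.Om d, (∀ i, 0 < z.1.1 i) → (∀ i, 0 < z.1.2 i) →
          (z.2 = 1 ∨ z.2 = -1) → (1 + z.2 * pcmp z.1.1 z.1.2 w p) / 2 = PacAux.LL g q z) →
        0 ≤ (1 / n : ℝ) * ∑ i, (1 + (s i).2 * pcmp (s i).1.1 (s i).1.2 w p) / 2 ∧
        |(1 / n : ℝ) * ∑ i, (1 + (s i).2 * pcmp (s i).1.1 (s i).1.2 w p) / 2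
          - ∫ z, (1 + z.2 * pcmp z.1.1 z.1.2 w p) / 2 ∂D| ≤ T / n := by
      intro g q h1 h2
      have h3 : ∀ z ∈ S, (1 + z.2 * pcmp z.1.1 z.1.2 w p) / 2 = PacAux.LL g q z := fun z hz =>
        h2 z (fun i => hmin.trans_le (hz.1 i).1) (fun i => hmin.trans_le (hz.2.1 i).1) hz.2.2
      have h4 : ∫ z, (1 + z.2 * pcmp z.1.1 z.1.2 w p) / 2 ∂D = ∫ z, PacAux.LL g q z ∂D :=
        integral_congr_ae (hSae.mono h3)
      have h5 : ∑ i, (1 + (s i).2 * pcmp (s i).1.1 (s i).1.2 w p) / 2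
          = ∑ i, PacAux.LL g q (s i) := Finset.sum_congr rfl fun i _ => h3 _ (hsS i)
      rw [h4, h5]
      refine ⟨mul_nonneg (by positivity) (Finset.sum_nonneg fun i _ => PacAux.ls_nonneg _ _), ?_⟩
      have h6 : (1 / n : ℝ) * ∑ i, PacAux.LL g q (s i) - ∫ z, PacAux.LL g q z ∂D
          = (∑ i, PacAux.LL g q (s i) - n * ∫ z, PacAux.LL g q z ∂D) / n := by
        field_simp
      rw [h6, abs_div, abs_of_pos hn0]
      gcongr
    rcases PacAux.reduce w hw p with ⟨q, hq⟩ | ⟨q, hq⟩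
    · refine hgen _ q ?_ hq
      by_contra hc
      exact hs1 ⟨q, not_le.1 hc⟩
    · refine hgen _ q ?_ hq
      by_contra hc
      exact hs2 ⟨q, not_le.1 hc⟩
  set Good := {s : Fin n → PacAux.Om d |
    (∫ z, (1 + z.2 * pcmp z.1.1 z.1.2 (erm s).1 (erm s).2) / 2 ∂D)
              - (⨅ q : {w : Fin d → ℝ // inSimplex w} × ℝ,
                    ∫ z, (1 + z.2 * pcmp z.1.1 z.1.2 q.1.1 q.2) / 2 ∂D)
            ≤ 16 * Real.sqrt (X / n)} with hGood
  have hcover : (Set.univ : Set (Fin n → PacAux.Om d)) ⊆ Good ∪ (N ∪ (B1 ∪ B2)) := by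
    intro s _
    by_cases h : s ∈ N ∪ (B1 ∪ B2)
    · exact Or.inr h
    left
    simp only [Set.mem_union, not_or] at h
    obtain ⟨hsN, hs1, hs2⟩ := h
    have hd' := hdev s hsN hs1 hs2
    obtain ⟨hsimp, hmineq⟩ := herm s
    rw [hGood, Set.mem_ofPred_eq, hTn]
    have : Nonempty ({w : Fin d → ℝ // inSimplex w} × ℝ) := ⟨(⟨(erm s).1, hsimp⟩, 0)⟩
    have hkey : ∀ q : {w : Fin d → ℝ // inSimplex w} × ℝ,
        (∫ z, (1 + z.2 * pcmp z.1.1 z.1.2 (erm s).1 (erm s).2) / 2 ∂D) - 2 * T / n ≤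
        ∫ z, (1 + z.2 * pcmp z.1.1 z.1.2 q.1.1 q.2) / 2 ∂D := by
      intro q
      have h1 := (abs_le.1 (hd' (erm s).1 (erm s).2 hsimp).2).1
      have h2 := (abs_le.1 (hd' q.1.1 q.2 q.1.2).2).2
      have h3 : (⨅ q : {w : Fin d → ℝ // inSimplex w} × ℝ,
            (1 / n : ℝ) * ∑ i, (1 + (s i).2 * pcmp (s i).1.1 (s i).1.2 q.1.1 q.2) / 2) ≤
            (1 / n : ℝ) * ∑ i, (1 + (s i).2 * pcmp (s i).1.1 (s i).1.2 q.1.1 q.2) / 2 :=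
        ciInf_le ⟨0, by
          rintro _ ⟨q', rfl⟩
          exact (hd' q'.1.1 q'.2 q'.1.2).1⟩ q
      rw [← hmineq] at h3
      have h4 : 2 * T / n = T / n + T / n := by ring
      linarith
    have := le_ciInf hkey
    linarith
  have hbad : μ (N ∪ (B1 ∪ B2)) ≤ ENNReal.ofReal δ := by
    calc μ (N ∪ (B1 ∪ B2)) ≤ μ N + (μ B1 + μ B2) :=
          (measure_union_le _ _).trans (add_le_add_right (measure_union_le _ _) _)
      _ ≤ 0 + (ENNReal.ofReal (δ / 2) + ENNReal.ofReal (δ / 2)) := by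
          rw [hN0]; gcongr
      _ = ENNReal.ofReal δ := by
          rw [zero_add, ← ENNReal.ofReal_add (by positivity) (by positivity)]; congr 1; ring
  have h1 : (1 : ENNReal) ≤ μ Good + ENNReal.ofReal δ := by
    calc (1 : ENNReal) = μ Set.univ := by rw [hμ, measure_univ]
      _ ≤ μ (Good ∪ (N ∪ (B1 ∪ B2))) := measure_mono hcover
      _ ≤ μ Good + μ (N ∪ (B1 ∪ B2)) := measure_union_le _ _
      _ ≤ _ := by gcongr
  change ENNReal.ofReal (1 - δ) ≤ μ Good
  rw [ENNReal.ofReal_sub _ hδ.le, ENNReal.ofReal_one]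
  exact tsub_le_iff_right.2 h1
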